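/- Let c > 2 and k ≥ 2 be integers and n := 2ck. The complete hypergraph K_n on n vertices satisfies herdisc(K_n, c) = (1 − 1/c)·n/c. -/

import Mathlib

open Finset

/-- `c`-color discrepancy of the subhypergraph of `(V, E)` induced on `V₀`:
minimum over colorings of the maximum over colors `d` and edges `e` of
`||χ⁻¹(d) ∩ e ∩ V₀| - |e ∩ V₀|/c|`. -/
noncomputable def hdiscSub {V : Type*} [Fintype V] [DecidableEq V]
    (E : Finset (Finset V)) (c : ℕ) (V₀ : Finset V) : ℝ :=
  ⨅ χ : V → Fin c, ⨆ d : Fin c, ⨆ e : E,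
    |(((e.1 ∩ V₀).filter (fun v => χ v = d)).card : ℝ) - ((e.1 ∩ V₀).card : ℝ) / c|

/-- `c`-color discrepancy of the hypergraph `(V, E)`. -/
noncomputable def hdisc {V : Type*} [Fintype V] [DecidableEq V]
    (E : Finset (Finset V)) (c : ℕ) : ℝ := hdiscSub E c Finset.univ

/-- hereditary `c`-color discrepancy: maximum over all induced subhypergraphs. -/
noncomputable def hherdisc {V : Type*} [Fintype V] [DecidableEq V]
    (E : Finset (Finset V)) (c : ℕ) : ℝ := ⨆ V₀ : Finset V, hdiscSub E c V₀

/-- The complete hypergraph on `n` vertices: every subset of the vertex set is an edge. -/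
def Kn (n : ℕ) : Finset (Finset (Fin n)) := Finset.univ

/-- An equitable coloring: all color classes have the same size. -/
theorem exists_equitable_coloring (c m : ℕ) :
    ∃ χ : Fin (c * m) → Fin c, ∀ d, (univ.filter (fun v => χ v = d)).card = m := by
  refine ⟨fun v => (finProdFinEquiv.symm v).1, fun d => ?_⟩
  have hinj : Function.Injective fun j : Fin m => finProdFinEquiv (d, j) :=
    fun a b hab => by simpa using hab
  have h : univ.filter (fun v : Fin (c * m) => (finProdFinEquiv.symm v).1 = d)
      = (univ : Finset (Fin m)).image (fun j => finProdFinEquiv (d, j)) := by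
    ext v
    simp only [mem_filter, mem_univ, true_and, mem_image]
    constructor
    · rintro rfl
      exact ⟨(finProdFinEquiv.symm v).2, finProdFinEquiv.apply_symm_apply v⟩
    · rintro ⟨j, rfl⟩
      rw [Equiv.symm_apply_apply]
  rw [h, card_image_of_injective _ hinj, card_univ, Fintype.card_fin]

/-- If every color class has `m` vertices, every vertex set `s` has imbalance at most
`(1 - 1 / c) * m` in every color. -/
theorem abs_card_filter_sub_le {c m : ℕ} (hc : 0 < c) (χ : Fin (c * m) → Fin c)
    (hχ : ∀ d, (univ.filter (fun v => χ v = d)).card = m) (s : Finset (Fin (c * m)))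
    (d : Fin c) :
    |((s.filter (fun v => χ v = d)).card : ℝ) - (s.card : ℝ) / c| ≤ (1 - 1 / (c : ℝ)) * m := by
  have hin : (s.filter (fun v => χ v = d)).card ≤ m :=
    (card_le_card (filter_subset_filter _ (subset_univ s))).trans (hχ d).le
  have hout : (s.filter (fun v => ¬ χ v = d)).card + m ≤ c * m := by
    have h := card_filter_add_card_filter_not (s := (univ : Finset (Fin (c * m))))
      (fun v => χ v = d)
    have h' := card_le_card (filter_subset_filter (fun v => ¬ χ v = d) (subset_univ s))
    rw [hχ d, card_univ, Fintype.card_fin] at h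
    omega
  have hs := card_filter_add_card_filter_not (s := s) (fun v => χ v = d)
  generalize (s.filter (fun v => χ v = d)).card = x at *
  generalize (s.filter (fun v => ¬ χ v = d)).card = y at *
  have hin' : (x : ℝ) ≤ m := by exact_mod_cast hin
  have hout' : (y : ℝ) + m ≤ c * m := by exact_mod_cast hout
  have hc' : (1 : ℝ) ≤ c := by exact_mod_cast hc
  have hx0 : (0 : ℝ) ≤ x := x.cast_nonneg
  have hy0 : (0 : ℝ) ≤ y := y.cast_nonneg
  have e1 : (x : ℝ) - (s.card : ℝ) / c = ((c - 1) * x - y) / c := by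
    rw [← hs]; push_cast; field_simp; ring
  have e2 : (1 - 1 / (c : ℝ)) * m = ((c - 1) * m) / c := by field_simp
  rw [e1, e2, abs_le, ← neg_div]
  constructor <;> gcongr <;> nlinarith

/-- Every coloring of `c * m` vertices has imbalance at least `(1 - 1 / c) * m` on some
color class. -/
theorem exists_le_abs_card_filter_sub {c m : ℕ} (hc : 0 < c) (χ : Fin (c * m) → Fin c) :
    ∃ (d : Fin c) (s : Finset (Fin (c * m))), (1 - 1 / (c : ℝ)) * m ≤
      |((s.filter (fun v => χ v = d)).card : ℝ) - (s.card : ℝ) / c| := by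
  have : Nonempty (Fin c) := ⟨⟨0, hc⟩⟩
  obtain ⟨d, hd⟩ := Fintype.exists_le_card_fiber_of_mul_le_card (n := m) χ (by simp)
  refine ⟨d, univ.filter (fun v => χ v = d), le_trans ?_ (le_abs_self _)⟩
  rw [filter_filter]
  simp only [and_self]
  have hd' : (m : ℝ) ≤ (univ.filter (fun v => χ v = d)).card := by exact_mod_cast hd
  have hc' : (1 : ℝ) / c ≤ 1 := by
    rw [div_le_one (by positivity)]; exact_mod_cast hc
  calc (1 - 1 / (c : ℝ)) * m
      ≤ (1 - 1 / (c : ℝ)) * (univ.filter (fun v => χ v = d)).card :=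
        mul_le_mul_of_nonneg_left hd' (by linarith)
    _ = _ := by ring

/-- The hereditary discrepancy of the complete hypergraph on `c * m` vertices. -/
theorem hherdisc_Kn_mul {c : ℕ} (hc : 0 < c) (m : ℕ) :
    hherdisc (Kn (c * m)) c = (1 - 1 / (c : ℝ)) * m := by
  have : Nonempty (Fin c) := ⟨⟨0, hc⟩⟩
  have : Nonempty (Kn (c * m)) := ⟨⟨∅, mem_univ _⟩⟩
  apply le_antisymm
  · refine ciSup_le fun V₀ => ?_
    obtain ⟨χ, hχ⟩ := exists_equitable_coloring c m
    exact (ciInf_le (Set.finite_range _).bddBelow χ).trans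
      (ciSup_le fun d => ciSup_le fun e => abs_card_filter_sub_le hc χ hχ _ d)
  · refine le_ciSup_of_le (Set.finite_range _).bddAbove univ (le_ciInf fun χ => ?_)
    obtain ⟨d, s, h⟩ := exists_le_abs_card_filter_sub hc χ
    refine le_ciSup_of_le (Set.finite_range _).bddAbove d
      (le_ciSup_of_le (Set.finite_range _).bddAbove ⟨s, mem_univ _⟩ ?_)
    simpa only [inter_univ] using h

/-- For c > 2, k ≥ 2 and n = 2ck, the complete hypergraph on n vertices satisfies
herdisc(K_n, c) = (1 − 1/c)·n/c. -/
theorem herdisc_complete (c k n : ℕ) (hc : 2 < c) (hk : 2 ≤ k) (hn : n = 2 * c * k) :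
    hherdisc (Kn n) c = (1 - 1 / (c : ℝ)) * (n : ℝ) / c := by
  obtain rfl : n = c * (2 * k) := by rw [hn]; ring
  have hc0 : (c : ℝ) ≠ 0 := by positivity
  rw [hherdisc_Kn_mul (by omega)]
  push_cast
  field_simp
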